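/- For every ε with 0 < ε < 1/2 and every positive integer n, the infimum of cap^T_n(E) over all closed sets E ⊆ ∂T with cap^T(E) = ε equals ε/(1 − (2 − 2^{1−n})ε) = 2^n ε/(2^n − (2^{n+1}−2)ε). -/

import Mathlib

open scoped ENNReal NNReal
open Filter Topology

noncomputable section

/-- The vertex set of the dyadic tree `T`: finite binary strings. The boundary `∂T`
is the set of infinite binary sequences `ℕ → Bool`. `pre ζ k` is the prefix of
length `k` of the boundary point `ζ`. -/
def pre (ζ : ℕ → Bool) (k : ℕ) : List Bool := List.ofFn (fun i : Fin k => ζ i)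

/-- The tree condenser capacity `cap^T_n(E)`: the infimum of `Σ_x φ(x)²` over
`φ : T → [0,∞)` with `Iφ(ζ) = Σ_{x ∈ P(ζ)} φ(x) ≥ 1` on `E` and `φ(x) = 0`
whenever `d(x) ≤ n-1`.  For `n = 0` this is the tree capacity `cap^T(E)`. -/
noncomputable def treeCapN (n : ℕ) (E : Set (ℕ → Bool)) : ℝ≥0∞ :=
  sInf { c | ∃ φ : List Bool → ℝ≥0,
    (∀ ζ ∈ E, 1 ≤ ∑' k : ℕ, (φ (pre ζ k) : ℝ≥0∞)) ∧
    (∀ x : List Bool, x.length < n → φ x = 0) ∧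
    c = ∑' x : List Bool, (φ x : ℝ≥0∞) ^ 2 }

/-- The tree capacity `cap^T(E)` of a set `E ⊆ ∂T`. -/
noncomputable def treeCap (E : Set (ℕ → Bool)) : ℝ≥0∞ := treeCapN 0 E

/-- The sequence `b, ζ 0, ζ 1, …`. -/
def consSeq (b : Bool) (ζ : ℕ → Bool) : ℕ → Bool
  | 0 => b
  | k + 1 => ζ k

/-- The part of `E` in the subtree below the child `b` of the root, as a subset of `∂T`. -/
def branch (E : Set (ℕ → Bool)) (b : Bool) : Set (ℕ → Bool) := consSeq b ⁻¹' E

/-- The function on the tree with value `a` at the root and `φ b` on the subtree below `b`. -/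
def node (a : ℝ≥0) (φ : Bool → List Bool → ℝ≥0) : List Bool → ℝ≥0
  | [] => a
  | b :: x => φ b x

/-- The squared `ℓ²` norm of a function on the tree. -/
def energy (φ : List Bool → ℝ≥0) : ℝ≥0∞ := ∑' x, (φ x : ℝ≥0∞) ^ 2

/-- The sum of `φ` along the geodesic ending at `ζ`. -/
def potential (φ : List Bool → ℝ≥0) (ζ : ℕ → Bool) : ℝ≥0∞ := ∑' k, (φ (pre ζ k) : ℝ≥0∞)

lemma consSeq_head_tail (ζ : ℕ → Bool) : consSeq (ζ 0) (fun k => ζ (k + 1)) = ζ := by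
  funext k
  cases k <;> rfl

lemma pre_zero (ζ : ℕ → Bool) : pre ζ 0 = [] := by simp [pre]

lemma pre_consSeq_succ (b : Bool) (ζ : ℕ → Bool) (k : ℕ) :
    pre (consSeq b ζ) (k + 1) = b :: pre ζ k := by
  simp [pre, List.ofFn_succ, consSeq]

lemma pre_succ (ζ : ℕ → Bool) (k : ℕ) : pre ζ (k + 1) = pre ζ k ++ [ζ k] := by
  simp [pre, List.ofFn_succ_last, -List.ofFn_succ]

lemma node_eta (φ : List Bool → ℝ≥0) : node (φ []) (fun b x => φ (b :: x)) = φ := by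
  funext x
  cases x <;> rfl

/-- A binary string is empty or consists of a first letter and a binary string. -/
def listBoolEquiv : Unit ⊕ (List Bool ⊕ List Bool) ≃ List Bool where
  toFun
    | .inl _ => []
    | .inr (.inl x) => false :: x
    | .inr (.inr x) => true :: x
  invFun
    | [] => .inl ()
    | false :: x => .inr (.inl x)
    | true :: x => .inr (.inr x)
  left_inv := by rintro (_ | _ | _) <;> rfl
  right_inv := by rintro (_ | ⟨_ | _, _⟩) <;> rfl

lemma energy_node (a : ℝ≥0) (φ : Bool → List Bool → ℝ≥0) :
    energy (node a φ) = (a : ℝ≥0∞) ^ 2 + (energy (φ false) + energy (φ true)) := by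
  unfold energy
  rw [← listBoolEquiv.tsum_eq]
  refine HasSum.tsum_eq (HasSum.sum ?_ (HasSum.sum ?_ ?_))
  · have := hasSum_unique
      ((fun x => ((node a φ (listBoolEquiv x) : ℝ≥0) : ℝ≥0∞) ^ 2) ∘ (Sum.inl : Unit → _))
    simpa [listBoolEquiv, node] using this
  · exact ENNReal.summable.hasSum
  · exact ENNReal.summable.hasSum

lemma potential_node_consSeq (a : ℝ≥0) (φ : Bool → List Bool → ℝ≥0) (b : Bool) (ζ : ℕ → Bool) :
    potential (node a φ) (consSeq b ζ) = a + potential (φ b) ζ := by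
  unfold potential
  rw [tsum_eq_zero_add' ENNReal.summable]
  simp [pre_zero, pre_consSeq_succ, node]

lemma energy_smul (a : ℝ≥0) (φ : List Bool → ℝ≥0) :
    energy (fun x => a * φ x) = (a : ℝ≥0∞) ^ 2 * energy φ := by
  simp [energy, mul_pow, ENNReal.tsum_mul_left]

lemma energy_zero : energy (fun _ => 0) = 0 := by simp [energy]

lemma potential_smul (a : ℝ≥0) (φ : List Bool → ℝ≥0) (ζ : ℕ → Bool) :
    potential (fun x => a * φ x) ζ = a * potential φ ζ := by
  simp [potential, ENNReal.tsum_mul_left]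

lemma treeCapN_le {n : ℕ} {E : Set (ℕ → Bool)} {φ : List Bool → ℝ≥0}
    (h : ∀ ζ ∈ E, 1 ≤ potential φ ζ) (h' : ∀ x : List Bool, x.length < n → φ x = 0) :
    treeCapN n E ≤ energy φ :=
  sInf_le ⟨φ, h, h', rfl⟩

lemma le_treeCapN {n : ℕ} {E : Set (ℕ → Bool)} {c : ℝ≥0∞}
    (h : ∀ φ : List Bool → ℝ≥0, (∀ ζ ∈ E, 1 ≤ potential φ ζ) →
      (∀ x : List Bool, x.length < n → φ x = 0) → c ≤ energy φ) :
    c ≤ treeCapN n E :=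
  le_sInf fun _ ⟨φ, h₁, h₂, he⟩ => he ▸ h φ h₁ h₂

lemma exists_energy_lt {n : ℕ} {E : Set (ℕ → Bool)} {c : ℝ≥0∞} (h : treeCapN n E < c) :
    ∃ φ : List Bool → ℝ≥0, (∀ ζ ∈ E, 1 ≤ potential φ ζ) ∧
      (∀ x : List Bool, x.length < n → φ x = 0) ∧ energy φ < c := by
  obtain ⟨_, ⟨φ, h₁, h₂, rfl⟩, h₃⟩ := sInf_lt_iff.1 h
  exact ⟨φ, h₁, h₂, h₃⟩

lemma treeCapN_succ (n : ℕ) (E : Set (ℕ → Bool)) :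
    treeCapN (n + 1) E = treeCapN n (branch E false) + treeCapN n (branch E true) := by
  apply le_antisymm
  · refine ENNReal.le_of_forall_pos_le_add fun δ hδ hfin => ?_
    have key (b : Bool) : ∃ φ : List Bool → ℝ≥0, (∀ ζ ∈ branch E b, 1 ≤ potential φ ζ) ∧
        (∀ x : List Bool, x.length < n → φ x = 0) ∧
        energy φ < treeCapN n (branch E b) + (δ / 2 : ℝ≥0) := by
      refine exists_energy_lt (ENNReal.lt_add_right ?_ (by simpa using hδ.ne'))
      cases b
      · exact (lt_of_le_of_lt le_self_add hfin).ne
      · exact (lt_of_le_of_lt le_add_self hfin).ne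
    choose φ h₁ h₂ h₃ using key
    calc treeCapN (n + 1) E ≤ energy (node 0 φ) := by
          refine treeCapN_le (fun ζ hζ => ?_) ?_
          · rw [← consSeq_head_tail ζ] at hζ ⊢
            rw [potential_node_consSeq]
            exact le_add_left (h₁ _ _ hζ)
          · rintro (_ | ⟨b, x⟩) hx
            · rfl
            · exact h₂ b x (by simpa using hx)
      _ = energy (φ false) + energy (φ true) := by simp [energy_node]
      _ ≤ _ := add_le_add (h₃ false).le (h₃ true).le
      _ = _ := by
        rw [add_add_add_comm, ← ENNReal.coe_add, add_halves]
  · refine le_treeCapN fun φ h₁ h₂ => ?_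
    rw [← node_eta φ, energy_node]
    refine le_add_left (add_le_add ?_ ?_) <;>
    · refine treeCapN_le (fun ζ hζ => ?_) fun x hx => h₂ _ (by simpa using hx)
      have := h₁ _ hζ
      rw [← node_eta φ, potential_node_consSeq, h₂ [] (by simp)] at this
      simpa using this

lemma treeCapN_zero_le (E : Set (ℕ → Bool)) {a b : ℝ≥0} (hab : a + b = 1) :
    treeCapN 0 E ≤ a ^ 2 + b ^ 2 * treeCapN 1 E := by
  rcases eq_or_ne (treeCapN 1 E) ⊤ with htop | hfin
  · rcases eq_or_ne b 0 with rfl | hb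
    · have ha : a = 1 := by simpa using hab
      subst ha
      refine (treeCapN_le (φ := node 1 fun _ _ => 0) (fun ζ _ => ?_) (by simp)).trans ?_
      · rw [← consSeq_head_tail ζ, potential_node_consSeq]
        simp
      · rw [energy_node, energy_zero]
        simp
    · rw [htop, ENNReal.mul_top (by simpa using hb)]
      simp
  refine ENNReal.le_of_forall_pos_le_add fun δ hδ _ => ?_
  obtain ⟨φ, h₁, h₂, h₃⟩ := exists_energy_lt
    (ENNReal.lt_add_right hfin (by simpa using hδ.ne' : (δ : ℝ≥0∞) ≠ 0))
  have h0 := h₂ [] (by simp)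
  rw [← node_eta φ, energy_node, h0] at h₃
  calc treeCapN 0 E ≤ energy (node a fun c x => b * φ (c :: x)) := by
        refine treeCapN_le (fun ζ hζ => ?_) (by simp)
        have := h₁ ζ hζ
        rw [← consSeq_head_tail ζ, ← node_eta φ, potential_node_consSeq, h0] at this
        rw [← consSeq_head_tail ζ, potential_node_consSeq, potential_smul]
        calc (1 : ℝ≥0∞) = a + b * 1 := by rw [mul_one]; exact_mod_cast hab.symm
          _ ≤ _ := by gcongr; rwa [ENNReal.coe_zero, zero_add] at this
    _ = a ^ 2 + b ^ 2 * (0 + (energy (fun x => φ (false :: x)) +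
          energy fun x => φ (true :: x))) := by
        rw [energy_node, energy_smul, energy_smul, zero_add, mul_add]
    _ ≤ a ^ 2 + b ^ 2 * (treeCapN 1 E + δ) := by
        exact add_le_add le_rfl (mul_le_mul' le_rfl (by simpa using h₃.le))
    _ ≤ a ^ 2 + b ^ 2 * treeCapN 1 E + δ := by
        rw [mul_add, ← add_assoc]
        gcongr
        refine mul_le_of_le_one_left' (pow_le_one' ?_ 2)
        exact_mod_cast hab ▸ le_add_self

lemma le_treeCapN_zero (E : Set (ℕ → Bool)) {c : ℝ≥0∞} (hc : c ≤ 1)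
    (h : ∀ a b : ℝ≥0, a + b = 1 → c ≤ a ^ 2 + b ^ 2 * treeCapN 1 E) :
    c ≤ treeCapN 0 E := by
  refine le_treeCapN fun φ h₁ _ => ?_
  rw [← node_eta φ, energy_node]
  rcases le_or_gt 1 (φ []) with ha | ha
  · refine le_add_right (hc.trans (one_le_pow₀ ?_))
    exact_mod_cast ha
  obtain ⟨b, hb⟩ := exists_add_of_le ha.le
  have hb0 : b ≠ 0 := by
    rintro rfl
    exact ha.ne (by simpa using hb.symm)
  refine (h _ b hb.symm).trans ?_
  rw [treeCapN_succ, mul_add]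
  have key (d : Bool) : (b : ℝ≥0∞) ^ 2 * treeCapN 0 (branch E d)
      ≤ energy fun x => φ (d :: x) := by
    have : treeCapN 0 (branch E d) ≤ energy fun x => b⁻¹ * φ (d :: x) := by
      refine treeCapN_le (fun ζ hζ => ?_) (by simp)
      have := h₁ _ hζ
      rw [← node_eta φ, potential_node_consSeq, ← ENNReal.coe_one, hb, ENNReal.coe_add,
        ENNReal.add_le_add_iff_left ENNReal.coe_ne_top] at this
      rw [potential_smul]
      calc (1 : ℝ≥0∞) = (b⁻¹ : ℝ≥0) * b := by
            rw [← ENNReal.coe_mul, inv_mul_cancel₀ hb0, ENNReal.coe_one]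
        _ ≤ _ := by gcongr
    calc _ ≤ (b : ℝ≥0∞) ^ 2 * energy fun x => b⁻¹ * φ (d :: x) := by gcongr
      _ = _ := by
        rw [energy_smul, ← mul_assoc, ← mul_pow, ← ENNReal.coe_mul, mul_inv_cancel₀ hb0]
        simp
  gcongr
  · exact key false
  · exact key true

lemma treeCapN_zero_le_one (E : Set (ℕ → Bool)) : treeCapN 0 E ≤ 1 := by
  simpa using treeCapN_zero_le E (add_zero 1)

lemma treeCapN_ne_top (n : ℕ) (E : Set (ℕ → Bool)) : treeCapN n E ≠ ⊤ := by
  induction n generalizing E with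
  | zero => exact ne_top_of_le_ne_top ENNReal.one_ne_top (treeCapN_zero_le_one E)
  | succ n ih => simp [treeCapN_succ, ih]

/-- The condenser capacity as a real number. -/
def realCap (n : ℕ) (E : Set (ℕ → Bool)) : ℝ := (treeCapN n E).toReal

lemma realCap_nonneg (n : ℕ) (E : Set (ℕ → Bool)) : 0 ≤ realCap n E := ENNReal.toReal_nonneg

lemma ofReal_realCap (n : ℕ) (E : Set (ℕ → Bool)) : ENNReal.ofReal (realCap n E) = treeCapN n E :=
  ENNReal.ofReal_toReal (treeCapN_ne_top n E)

lemma realCap_succ (n : ℕ) (E : Set (ℕ → Bool)) :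
    realCap (n + 1) E = realCap n (branch E false) + realCap n (branch E true) := by
  rw [realCap, treeCapN_succ, ENNReal.toReal_add (treeCapN_ne_top _ _) (treeCapN_ne_top _ _)]
  rfl

lemma realCap_zero (E : Set (ℕ → Bool)) : realCap 0 E = realCap 1 E / (1 + realCap 1 E) := by
  have hs := realCap_nonneg 1 E
  apply le_antisymm
  · have h := treeCapN_zero_le E (a := (realCap 1 E / (1 + realCap 1 E)).toNNReal)
      (b := (1 / (1 + realCap 1 E)).toNNReal) (by
        rw [← Real.toNNReal_add (by positivity) (by positivity), ← add_div, add_comm,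
          div_self (by positivity), Real.toNNReal_one])
    have h' := ENNReal.toReal_mono (by finiteness [treeCapN_ne_top 1 E]) h
    rw [ENNReal.toReal_add (by finiteness) (by finiteness [treeCapN_ne_top 1 E])] at h'
    simp only [ENNReal.toReal_mul, ENNReal.toReal_pow, ENNReal.coe_toReal] at h'
    rw [Real.coe_toNNReal _ (by positivity), Real.coe_toNNReal _ (by positivity)] at h'
    refine h'.trans_eq ?_
    change _ + _ * realCap 1 E = _
    field_simp
    ring
  · refine (ENNReal.ofReal_le_iff_le_toReal (treeCapN_ne_top 0 E)).1 ?_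
    refine le_treeCapN_zero E ?_ fun a b hab => ?_
    · rw [ENNReal.ofReal_le_one]
      exact div_le_one_of_le₀ (by linarith) (by positivity)
    · have hab' : (a : ℝ) + b = 1 := by exact_mod_cast hab
      rw [ENNReal.ofReal_le_iff_le_toReal (by finiteness [treeCapN_ne_top 1 E]),
        ENNReal.toReal_add (by finiteness) (by finiteness [treeCapN_ne_top 1 E])]
      simp only [ENNReal.toReal_mul, ENNReal.toReal_pow, ENNReal.coe_toReal]
      change _ ≤ _ + _ * realCap 1 E
      rw [div_le_iff₀ (by positivity), eq_sub_of_add_eq hab']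
      nlinarith [sq_nonneg (1 - (b : ℝ) - b * realCap 1 E)]

lemma realCap_zero_lt_one (E : Set (ℕ → Bool)) : realCap 0 E < 1 := by
  have := realCap_nonneg 1 E
  rw [realCap_zero, div_lt_one (by positivity)]
  linarith

lemma realCap_one (E : Set (ℕ → Bool)) : realCap 1 E = realCap 0 E / (1 - realCap 0 E) := by
  have h := realCap_nonneg 1 E
  rw [realCap_zero]
  have : 1 + realCap 1 E ≠ 0 := by positivity
  field_simp
  ring_nf

lemma realCap_zero_le_half (E : Set (ℕ → Bool)) : realCap 0 E ≤ 1 / 2 := by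
  have key (k : ℕ) : ∀ E, realCap 0 E ≤ 1 / 2 + (1 / 2) ^ k := by
    induction k with
    | zero => exact fun E => (realCap_zero_lt_one E).le.trans (by norm_num)
    | succ k ih =>
      intro E
      have h := realCap_succ 0 E
      have h' := realCap_nonneg 1 E
      have h₁ := ih (branch E false)
      have h₂ := ih (branch E true)
      have hp : (0 : ℝ) < (1 / 2) ^ k := by positivity
      rw [realCap_zero, div_le_iff₀ (by positivity), pow_succ]
      have hp' : (1 / 2 : ℝ) ^ k ≤ 1 := pow_le_one₀ (by norm_num) (by norm_num)
      simp only [zero_add] at h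
      nlinarith [mul_nonneg (sub_nonneg.2 hp')
        (by linarith : 0 ≤ 1 + 2 * (1 / 2 : ℝ) ^ k - realCap 1 E)]
  have hlim : Tendsto (fun k : ℕ => (1 / 2 : ℝ) + (1 / 2) ^ k) atTop (𝓝 (1 / 2 + 0)) :=
    (tendsto_pow_atTop_nhds_zero_of_lt_one (by norm_num) (by norm_num)).const_add _
  rw [add_zero] at hlim
  exact ge_of_tendsto' hlim fun k => key k E

lemma realCap_empty : realCap 0 ∅ = 0 := by
  have : treeCapN 0 ∅ ≤ energy fun _ => 0 := treeCapN_le (by simp) (by simp)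
  rw [energy_zero, nonpos_iff_eq_zero] at this
  simp [realCap, this]

lemma exists_energy_branch_le (φ : List Bool → ℝ≥0) :
    ∃ b, energy (fun x => φ (b :: x)) ≤ energy φ / 2 := by
  by_contra! h
  have h' := ENNReal.add_lt_add (h false) (h true)
  rw [ENNReal.add_halves] at h'
  refine h'.not_ge ?_
  nth_rw 3 [← node_eta φ]
  rw [energy_node]
  exact le_add_self

/-- Iteratively restrict `φ` to the subtree of a child of the root carrying at most half of
the energy. -/
def lightBranch (φ : List Bool → ℝ≥0) : ℕ → List Bool → ℝ≥0
  | 0 => φ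
  | k + 1 => fun x => lightBranch φ k ((exists_energy_branch_le (lightBranch φ k)).choose :: x)

/-- The boundary point whose geodesic follows `lightBranch φ`. -/
def lightPoint (φ : List Bool → ℝ≥0) (k : ℕ) : Bool :=
  (exists_energy_branch_le (lightBranch φ k)).choose

lemma lightBranch_apply (φ : List Bool → ℝ≥0) (k : ℕ) (x : List Bool) :
    lightBranch φ k x = φ (pre (lightPoint φ) k ++ x) := by
  induction k generalizing x with
  | zero => simp [lightBranch, pre_zero]
  | succ k ih =>
    change lightBranch φ k (lightPoint φ k :: x) = _
    rw [ih, pre_succ, List.append_assoc]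
    rfl

lemma energy_lightBranch_le (φ : List Bool → ℝ≥0) (k : ℕ) :
    energy (lightBranch φ k) ≤ energy φ * (2⁻¹) ^ k := by
  induction k with
  | zero => simp [lightBranch]
  | succ k ih =>
    refine (exists_energy_branch_le (lightBranch φ k)).choose_spec.trans ?_
    rw [pow_succ, ← mul_assoc, ENNReal.div_eq_inv_mul, mul_comm]
    gcongr

lemma le_energy_of_one_le_potential {φ : List Bool → ℝ≥0} (h : ∀ ζ, 1 ≤ potential φ ζ) :
    ENNReal.ofReal (1 / 25) ≤ energy φ := by
  by_contra! hlt
  have hval (k : ℕ) : (φ (pre (lightPoint φ) k) : ℝ≥0∞) ≤ ENNReal.ofReal (1 / 5 * (3 / 4) ^ k) := by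
    have h₁ : (φ (pre (lightPoint φ) k) : ℝ≥0∞) ^ 2 ≤ energy (lightBranch φ k) := by
      have := lightBranch_apply φ k []
      rw [List.append_nil] at this
      rw [← this]
      exact ENNReal.le_tsum (f := fun x => (lightBranch φ k x : ℝ≥0∞) ^ 2) []
    refine (ENNReal.pow_le_pow_left_iff two_ne_zero).1 ?_
    calc _ ≤ energy φ * (2⁻¹) ^ k := h₁.trans (energy_lightBranch_le φ k)
      _ ≤ ENNReal.ofReal (1 / 25) * (ENNReal.ofReal (2⁻¹)) ^ k := by
        gcongr
        rw [ENNReal.ofReal_inv_of_pos two_pos, ENNReal.ofReal_ofNat]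
      _ = ENNReal.ofReal (1 / 25 * 2⁻¹ ^ k) := by
        rw [ENNReal.ofReal_mul (by norm_num), ENNReal.ofReal_pow (by norm_num)]
      _ ≤ ENNReal.ofReal ((1 / 5 * (3 / 4) ^ k) ^ 2) := by
        apply ENNReal.ofReal_le_ofReal
        rw [mul_pow, ← pow_mul, mul_comm k, pow_mul]
        gcongr <;> norm_num
      _ = _ := ENNReal.ofReal_pow (by positivity) 2
  have hsum : Summable fun k : ℕ => (1 / 5 : ℝ) * (3 / 4) ^ k :=
    (summable_geometric_of_lt_one (by norm_num) (by norm_num)).mul_left _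
  have := (h (lightPoint φ)).trans (ENNReal.tsum_le_tsum hval)
  rw [← ENNReal.ofReal_tsum_of_nonneg (fun k => by positivity) hsum, tsum_mul_left,
    tsum_geometric_of_lt_one (by norm_num) (by norm_num), ENNReal.one_le_ofReal] at this
  norm_num at this

lemma realCap_univ : realCap 0 Set.univ = 1 / 2 := by
  have hpos : 1 / 25 ≤ realCap 0 Set.univ :=
    (ENNReal.ofReal_le_iff_le_toReal (treeCapN_ne_top 0 _)).1
      (le_treeCapN fun φ h _ => le_energy_of_one_le_potential fun ζ => h ζ (Set.mem_univ ζ))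
  have h := realCap_zero Set.univ
  rw [realCap_succ 0 Set.univ] at h
  simp only [branch, Set.preimage_univ] at h
  rw [eq_div_iff (by positivity)] at h
  have : realCap 0 Set.univ * (2 * realCap 0 Set.univ - 1) = 0 := by linarith
  rcases mul_eq_zero.1 this with h | h <;> linarith

/-- The capacity of the branch below the given child, in a set of capacity `t` filling up the
branch below `false` as far as possible. -/
def childCap (t : ℝ) (b : Bool) : ℝ :=
  bif b then t / (1 - t) - min (t / (1 - t)) (1 / 2) else min (t / (1 - t)) (1 / 2)

/-- The capacity of the part below the `k`-th vertex of the geodesic to `ζ`, in the set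
constructed by iterating `childCap`. -/
def vertexCap (t : ℝ) (ζ : ℕ → Bool) : ℕ → ℝ
  | 0 => t
  | k + 1 => vertexCap (childCap t (ζ 0)) (fun i => ζ (i + 1)) k

/-- An initial segment of `∂T` in the lexicographic order which has capacity `t`. -/
def capSegment (t : ℝ) : Set (ℕ → Bool) := {ζ | ∀ k, 0 < vertexCap t ζ k}

lemma childCap_add (t : ℝ) : childCap t false + childCap t true = t / (1 - t) := by
  simp [childCap]

lemma branch_capSegment {t : ℝ} (ht : 0 < t) (b : Bool) :
    branch (capSegment t) b = capSegment (childCap t b) := by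
  ext ζ
  exact ⟨fun h k => h (k + 1), fun h k => k.casesOn ht h⟩

lemma isClosed_capSegment (t : ℝ) : IsClosed (capSegment t) := by
  have : capSegment t = ⋂ k, {ζ | 0 < vertexCap t ζ k} := by
    ext ζ
    simp [capSegment]
  rw [this]
  refine isClosed_iInter fun k => ?_
  clear this
  induction k generalizing t with
  | zero => exact (isClosed_const : IsClosed {_ζ : ℕ → Bool | 0 < t})
  | succ k ih =>
    have : {ζ | 0 < vertexCap t ζ (k + 1)} = ⋃ b, {ζ : ℕ → Bool | ζ 0 = b} ∩
        (fun ζ i => ζ (i + 1)) ⁻¹' {ζ | 0 < vertexCap (childCap t b) ζ k} := by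
      ext ζ
      simp [vertexCap]
    rw [this]
    exact isClosed_iUnion_of_finite fun b =>
      (isClosed_eq (continuous_apply 0) continuous_const).inter
        ((ih _).preimage (continuous_pi fun i => continuous_apply (i + 1)))

lemma capSegment_zero : capSegment 0 = ∅ :=
  Set.eq_empty_of_forall_notMem fun _ h => lt_irrefl _ (h 0)

lemma childCap_half (b : Bool) : childCap (1 / 2) b = 1 / 2 := by
  cases b <;> norm_num [childCap]

lemma capSegment_half : capSegment (1 / 2) = Set.univ := by
  refine Set.eq_univ_of_forall fun ζ k => ?_
  suffices h : vertexCap (1 / 2) ζ k = 1 / 2 by rw [h]; norm_num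
  induction k generalizing ζ with
  | zero => rfl
  | succ k ih => rw [vertexCap, childCap_half, ih]

lemma abs_div_one_add_sub_le {s u δ : ℝ} (hs : 0 ≤ s) (hu : 0 ≤ u) (h : |s - u| ≤ δ) :
    |s / (1 + s) - u / (1 + u)| ≤ δ / (1 + δ) := by
  have key {s u : ℝ} (hs : 0 ≤ s) (hu : 0 ≤ u) (h : s - u ≤ δ) (hδ : 0 ≤ δ) :
      s / (1 + s) - u / (1 + u) ≤ δ / (1 + δ) := by
    rw [div_sub_div _ _ (by positivity) (by positivity), div_le_div_iff₀ (by positivity)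
      (by positivity)]
    nlinarith [mul_nonneg hs hu, mul_nonneg hδ hu, mul_nonneg hδ (mul_nonneg hs hu)]
  have hδ := (abs_nonneg _).trans h
  rw [abs_le] at h
  rw [abs_sub_le_iff]
  exact ⟨key hs hu h.2 hδ, key hu hs (by linarith) hδ⟩

lemma abs_realCap_capSegment_sub_le (k : ℕ) {t : ℝ} (h0 : 0 ≤ t) (h1 : t ≤ 1 / 2) :
    |realCap 0 (capSegment t) - t| ≤ 1 / (k + 1) := by
  induction k generalizing t with
  | zero =>
    have h := realCap_nonneg 0 (capSegment t)
    have h' := realCap_zero_le_half (capSegment t)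
    rw [abs_le]
    constructor <;> norm_num <;> linarith
  | succ k ih =>
    rcases h0.eq_or_lt with rfl | h0
    · rw [capSegment_zero, realCap_empty, sub_zero, abs_zero]
      positivity
    have ht : 0 < 1 - t := by linarith
    have hs : 0 ≤ t / (1 - t) := by positivity
    have hs' : t / (1 - t) ≤ 1 := by rw [div_le_one ht]; linarith
    have hadd := realCap_succ 0 (capSegment t)
    rw [branch_capSegment h0, branch_capSegment h0] at hadd
    have hclose : |realCap 1 (capSegment t) - t / (1 - t)| ≤ 1 / (k + 1) := by
      simp only [zero_add] at hadd
      rw [hadd, ← childCap_add]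
      rcases le_total (t / (1 - t)) (1 / 2) with h | h
      · have h₁ : childCap t false = t / (1 - t) := by simp only [childCap, cond_false, min_eq_left h]
        have h₂ : childCap t true = 0 := by simp only [childCap, cond_true, min_eq_left h, sub_self]
        rw [h₁, h₂, capSegment_zero, realCap_empty, add_zero, add_zero]
        exact ih hs h
      · have h₁ : childCap t false = 1 / 2 := by simp only [childCap, cond_false, min_eq_right h]
        have h₂ : childCap t true = t / (1 - t) - 1 / 2 := by
          simp only [childCap, cond_true, min_eq_right h]
        rw [h₁, h₂, capSegment_half, realCap_univ, add_sub_add_left_eq_sub]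
        exact ih (by linarith) (by linarith)
    have hmain := abs_div_one_add_sub_le (realCap_nonneg _ _) hs hclose
    have e₁ : t / (1 - t) / (1 + t / (1 - t)) = t := by
      field_simp
      ring
    have e₂ : 1 / ((k : ℝ) + 1) / (1 + 1 / (k + 1)) = 1 / ((k + 1 : ℕ) + 1) := by
      push_cast
      field_simp
    rwa [← realCap_zero, e₁, e₂] at hmain

lemma realCap_capSegment {t : ℝ} (h0 : 0 ≤ t) (h1 : t ≤ 1 / 2) :
    realCap 0 (capSegment t) = t := by
  have := ge_of_tendsto' tendsto_one_div_add_atTop_nhds_zero_nat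
    fun k => abs_realCap_capSegment_sub_le k h0 h1
  exact sub_eq_zero.1 (abs_nonpos_iff.1 this)

/-- The coefficient of `ε` in the denominator of the extremal condenser capacity. -/
def condenserCoeff (n : ℕ) : ℝ := 2 - 2 * (1 / 2) ^ n

lemma condenserCoeff_succ (n : ℕ) : condenserCoeff (n + 1) = 1 + condenserCoeff n / 2 := by
  rw [condenserCoeff, condenserCoeff, pow_succ]
  ring

lemma condenserCoeff_nonneg (n : ℕ) : 0 ≤ condenserCoeff n := by
  have : (1 / 2 : ℝ) ^ n ≤ 1 := pow_le_one₀ (by norm_num) (by norm_num)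
  rw [condenserCoeff]
  linarith

lemma condenserCoeff_mul_lt_one (n : ℕ) {x : ℝ} (h1 : x ≤ 1 / 2) :
    condenserCoeff n * x < 1 := by
  have : condenserCoeff n < 2 := by
    have : (0 : ℝ) < (1 / 2) ^ n := by positivity
    rw [condenserCoeff]
    linarith
  nlinarith [condenserCoeff_nonneg n]

lemma div_one_sub_mul_midpoint_le {a x y : ℝ} (ha : 0 ≤ a) (hx : a * x < 1) (hy : a * y < 1) :
    (x + y) / (1 - a * ((x + y) / 2)) ≤ x / (1 - a * x) + y / (1 - a * y) := by
  have hp : 0 < 1 - a * x := by linarith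
  have hq : 0 < 1 - a * y := by linarith
  have hm : 0 < 1 - a * ((x + y) / 2) := by linarith
  have : x / (1 - a * x) + y / (1 - a * y) - (x + y) / (1 - a * ((x + y) / 2)) =
      a * (x - y) ^ 2 / (2 * (1 - a * ((x + y) / 2)) * (1 - a * x) * (1 - a * y)) := by
    rw [div_add_div _ _ hp.ne' hq.ne', div_sub_div _ _ (by positivity) hm.ne',
      div_eq_div_iff (by positivity) (by positivity)]
    ring
  rw [← sub_nonneg, this]
  positivity

lemma div_one_sub_condenserCoeff_succ (n : ℕ) {ε : ℝ} (h1 : ε < 1) :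
    ε / (1 - condenserCoeff (n + 1) * ε) =
      ε / (1 - ε) / (1 - condenserCoeff n * (ε / (1 - ε) / 2)) := by
  have h : 1 - ε ≠ 0 := by linarith
  have : 1 - condenserCoeff n * (ε / (1 - ε) / 2) =
      (1 - condenserCoeff (n + 1) * ε) / (1 - ε) := by
    rw [condenserCoeff_succ]
    field_simp
    ring
  rw [this, div_div_div_cancel_right₀ h]

lemma le_realCap (n : ℕ) (E : Set (ℕ → Bool)) :
    realCap 0 E / (1 - condenserCoeff n * realCap 0 E) ≤ realCap n E := by
  induction n generalizing E with
  | zero => simp [condenserCoeff]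
  | succ n ih =>
    have hadd := realCap_succ 0 E
    rw [zero_add, realCap_one] at hadd
    rw [div_one_sub_condenserCoeff_succ n (realCap_zero_lt_one E), hadd, realCap_succ]
    exact (div_one_sub_mul_midpoint_le (condenserCoeff_nonneg n)
      (condenserCoeff_mul_lt_one n (realCap_zero_le_half _))
      (condenserCoeff_mul_lt_one n (realCap_zero_le_half _))).trans
        (add_le_add (ih _) (ih _))

lemma exists_realCap_eq (n : ℕ) {ε : ℝ} (h0 : 0 ≤ ε) (h1 : ε ≤ 1 / 2) :
    ∃ E : Set (ℕ → Bool), IsClosed E ∧ realCap 0 E = ε ∧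
      realCap n E = ε / (1 - condenserCoeff n * ε) := by
  induction n generalizing ε with
  | zero =>
    have h := realCap_capSegment h0 h1
    exact ⟨capSegment ε, isClosed_capSegment ε, h, by simp [h, condenserCoeff]⟩
  | succ n ih =>
    have hε : 0 < 1 - ε := by linarith
    obtain ⟨E, hE, h, h'⟩ := ih (ε := ε / (1 - ε) / 2) (by positivity)
      (by gcongr; rw [div_le_one hε]; linarith)
    have hbranch (b : Bool) : branch ((fun ζ i => ζ (i + 1)) ⁻¹' E) b = E := rfl
    refine ⟨(fun ζ i => ζ (i + 1)) ⁻¹' E,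
      hE.preimage (continuous_pi fun i => continuous_apply (i + 1)), ?_, ?_⟩
    · rw [realCap_zero, realCap_succ, hbranch, hbranch, h, add_halves]
      field_simp
      ring
    · rw [realCap_succ, hbranch, hbranch, h', ← add_div, add_halves,
        div_one_sub_condenserCoeff_succ n (by linarith)]

/-- For every `ε` with `0 < ε < 1/2` and every positive integer `n`,
the infimum of `cap^T_n(E)` over all closed `E ⊆ ∂T` with `cap^T(E) = ε` equals
`ε/(1 - (2 - 2^{1-n})ε) = 2^n ε/(2^n - (2^{n+1} - 2)ε)`. -/
theorem tree_condenser_inf_formula (ε : ℝ) (h0 : 0 < ε) (h1 : ε < 1/2)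
    (n : ℕ) (hn : 1 ≤ n) :
    sInf { c : ℝ≥0∞ | ∃ E : Set (ℕ → Bool), IsClosed E ∧
        treeCap E = ENNReal.ofReal ε ∧ c = treeCapN n E }
      = ENNReal.ofReal (ε / (1 - (2 - 2 ^ (1 - (n:ℤ))) * ε)) ∧
    ε / (1 - (2 - (2:ℝ) ^ (1 - (n:ℤ))) * ε)
      = 2 ^ n * ε / (2 ^ n - (2 ^ (n+1) - 2) * ε) := by
  have hcoeff : (2 : ℝ) - 2 ^ (1 - (n : ℤ)) = condenserCoeff n := by
    rw [condenserCoeff, zpow_sub₀ two_ne_zero, zpow_one, zpow_natCast, one_div, inv_pow,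
      div_eq_mul_inv]
  rw [hcoeff]
  refine ⟨le_antisymm ?_ (le_sInf ?_), ?_⟩
  · obtain ⟨E, hE, h, h'⟩ := exists_realCap_eq n h0.le h1.le
    refine sInf_le ⟨E, hE, ?_, ?_⟩
    · rw [treeCap, ← ofReal_realCap, h]
    · rw [← h', ofReal_realCap]
  · rintro _ ⟨E, -, hE, rfl⟩
    have h : realCap 0 E = ε := by
      change (treeCap E).toReal = ε
      rw [hE, ENNReal.toReal_ofReal h0.le]
    rw [← ofReal_realCap, ← h]
    exact ENNReal.ofReal_le_ofReal (le_realCap n E)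
  · have h2 : (2 : ℝ) ^ n ≠ 0 := by positivity
    rw [← mul_div_mul_left _ _ h2]
    congr 1
    rw [condenserCoeff, one_div, inv_pow, pow_succ]
    field_simp
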